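/- Every salami is recurrent: if G=(V,w,m,d) is a salami, then for every ε > 0 there exists a finitely supported function f : V → ℝ with ‖f‖∞ = 1 and -⟨f, Δf⟩ < ε. -/

import Mathlib

open Filter

namespace SalamiPaper

variable {V : Type*}

/-- Locally finite: every vertex has finitely many neighbors. -/
def LocallyFinite (w : V → V → ℝ) : Prop := ∀ x : V, {y | 0 < w x y}.Finite

/-- Connectedness of the weighted graph: any two vertices are joined by a path. -/
def GraphConnected (w : V → V → ℝ) : Prop :=
  ∀ x y : V, Relation.ReflTransGen (fun a b => 0 < w a b) x y

/-- The weighted graph Laplacian `Δf(x) = (1/m(x)) ∑_y w(x,y)(f(y)-f(x))`. -/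
noncomputable def lap (w : V → V → ℝ) (m : V → ℝ) (f : V → ℝ) (x : V) : ℝ :=
  (m x)⁻¹ * ∑ᶠ y, w x y * (f y - f x)

/-- The vertex degree `Deg(x) = (1/m(x)) ∑_y w(x,y)`. -/
noncomputable def deg (w : V → V → ℝ) (m : V → ℝ) (x : V) : ℝ :=
  (m x)⁻¹ * ∑ᶠ y, w x y

/-- The set of `d`-lengths of adjacency paths from `x` to `y`. -/
def pathLens (w : V → V → ℝ) (d : V → V → ℝ) (x y : V) : Set ℝ :=
  {L | ∃ (n : ℕ) (p : ℕ → V), p 0 = x ∧ p n = y ∧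
    (∀ i < n, 0 < w (p i) (p (i + 1))) ∧
    L = ∑ i ∈ Finset.range n, d (p i) (p (i + 1))}

/-- `d` is a path metric on the graph with edge weight `w`. -/
def IsPathMetric (w : V → V → ℝ) (d : V → V → ℝ) : Prop :=
  (∀ x, d x x = 0) ∧ (∀ x y, x ≠ y → 0 < d x y) ∧ (∀ x y, d x y = d y x) ∧
  (∀ x y z, d x z ≤ d x y + d y z) ∧
  (∀ x y, d x y = sInf (pathLens w d x y))

/-- All balls are finite. -/
def FiniteBalls (d : V → V → ℝ) : Prop := ∀ (x : V) (R : ℝ), {y | d x y ≤ R}.Finite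

/-- The combinatorial graph distance (as a real number). -/
noncomputable def combDist (w : V → V → ℝ) (x y : V) : ℝ :=
  sInf {L | ∃ (n : ℕ) (p : ℕ → V), p 0 = x ∧ p n = y ∧
    (∀ i < n, 0 < w (p i) (p (i + 1))) ∧ L = (n : ℝ)}

/-- `Lip(1)`: the 1-Lipschitz functions with respect to `d`. -/
def Lip1 (d : V → V → ℝ) (f : V → ℝ) : Prop := ∀ x y, f y - f x ≤ d x y

/-- The Ollivier curvature
`κ(x,y) = (1/d(x,y)) inf{Δf(x) - Δf(y) : f ∈ Lip(1), f(y)-f(x) = d(x,y)}`. -/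
noncomputable def kappa (w : V → V → ℝ) (m : V → ℝ) (d : V → V → ℝ) (x y : V) : ℝ :=
  (d x y)⁻¹ * sInf {c | ∃ f : V → ℝ, Lip1 d f ∧ f y - f x = d x y ∧
    c = lap w m f x - lap w m f y}

/-- `m(A) = ∞`: the total measure of `A` is infinite. -/
def InfVolume (m : V → ℝ) (A : Set V) : Prop :=
  ∀ c : ℝ, ∃ F : Finset V, ↑F ⊆ A ∧ c < ∑ x ∈ F, m x

/-- A salami partition `(X,Y,K)`. -/
def SalamiPartition (w : V → V → ℝ) (m : V → ℝ) (X Y K : Set V) : Prop :=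
  X ∪ Y ∪ K = Set.univ ∧ Disjoint X Y ∧ Disjoint X K ∧ Disjoint Y K ∧
  K.Finite ∧ (∀ x ∈ X, ∀ y ∈ Y, w x y = 0) ∧ InfVolume m X ∧ InfVolume m Y

/-- Reachability inside a subset `A` of the vertex set. -/
def reachIn (w : V → V → ℝ) (A : Set V) : V → V → Prop :=
  Relation.ReflTransGen (fun a b => a ∈ A ∧ b ∈ A ∧ 0 < w a b)

/-- The induced subgraph on `A` is connected. -/
def ConnectedIn (w : V → V → ℝ) (A : Set V) : Prop :=
  ∀ x ∈ A, ∀ y ∈ A, reachIn w A x y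

/-- A connected salami partition: `K` induces a connected subgraph. -/
def ConnectedSalamiPartition (w : V → V → ℝ) (m : V → ℝ) (X Y K : Set V) : Prop :=
  SalamiPartition w m X Y K ∧ ConnectedIn w K

/-- The basic standing assumptions on a weighted graph `G = (V,w,m,d)`:
countable vertex set, symmetric non-negative edge weight vanishing on the diagonal,
positive vertex measure, local finiteness, connectedness,
`d` a path metric with finite balls. -/
def IsGraphBase (w : V → V → ℝ) (m : V → ℝ) (d : V → V → ℝ) : Prop :=
  Countable V ∧ (∀ x y, w x y = w y x) ∧ (∀ x y, 0 ≤ w x y) ∧ (∀ x, w x x = 0) ∧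
  (∀ x, 0 < m x) ∧ LocallyFinite w ∧ GraphConnected w ∧
  IsPathMetric w d ∧ FiniteBalls d

/-- Non-negative Ollivier curvature on all edges. -/
def NonnegCurv (w : V → V → ℝ) (m : V → ℝ) (d : V → V → ℝ) : Prop :=
  ∀ x y, 0 < w x y → 0 ≤ kappa w m d x y

/-- A salami: a connected, locally finite weighted graph with a path metric with
finite balls, non-negative Ollivier curvature, admitting a salami partition. -/
def IsSalami (w : V → V → ℝ) (m : V → ℝ) (d : V → V → ℝ) : Prop :=
  IsGraphBase w m d ∧ NonnegCurv w m d ∧ ∃ X Y K : Set V, SalamiPartition w m X Y K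

/-- `G` has at least `n` ends: there is a finite set `K` such that `V ∖ K` has at
least `n` infinite connected components. -/
def atLeastEnds (w : V → V → ℝ) (n : ℕ) : Prop :=
  ∃ K : Set V, K.Finite ∧ ∃ x : Fin n → V,
    (∀ i, x i ∉ K) ∧ (∀ i, {y | reachIn w Kᶜ (x i) y}.Infinite) ∧
    (∀ i j, i ≠ j → ¬ reachIn w Kᶜ (x i) (x j))

/-- `Lip(1,K)`: functions that are 1-Lipschitz on `K`. -/
def Lip1On (d : V → V → ℝ) (K : Set V) (f : V → ℝ) : Prop :=
  ∀ x ∈ K, ∀ y ∈ K, f y - f x ≤ d x y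

open Classical in
/-- The extremal Lipschitz extension operator `S(P)` of the salami partition
`P = (X,Y,K)`. -/
noncomputable def Sop (d : V → V → ℝ) (X Y K : Set V) (f : V → ℝ) : V → ℝ :=
  fun v =>
    if v ∈ K then f v
    else if v ∈ X then sSup {c | ∃ u ∈ K, c = f u - d v u}
    else sInf {c | ∃ u ∈ K, c = f u + d v u}

/-- `ℱ(P) = S(P)(Lip(1,K))`. -/
def calF (d : V → V → ℝ) (X Y K : Set V) : Set (V → ℝ) :=
  {g | ∃ f : V → ℝ, Lip1On d K f ∧ g = Sop d X Y K f}

/-- `ℋ(P)`: the harmonic functions in `ℱ(P)`. -/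
def calH (w : V → V → ℝ) (m : V → ℝ) (d : V → V → ℝ) (X Y K : Set V) :
    Set (V → ℝ) :=
  {g | g ∈ calF d X Y K ∧ ∀ x, lap w m g x = 0}

/-- `∇₊f(x) = max_{y∼x} (f(y)-f(x))/d(x,y)`. -/
noncomputable def gradPlus (w : V → V → ℝ) (d : V → V → ℝ) (f : V → ℝ) (x : V) : ℝ :=
  sSup {c | ∃ y, 0 < w x y ∧ c = (f y - f x) / d x y}

/-- `∇₋f(x) = max_{y∼x} (f(x)-f(y))/d(x,y)`. -/
noncomputable def gradMinus (w : V → V → ℝ) (d : V → V → ℝ) (f : V → ℝ) (x : V) : ℝ :=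
  sSup {c | ∃ y, 0 < w x y ∧ c = (f x - f y) / d x y}

/-- `|∇f|(x) = max_{y∼x} |f(y)-f(x)|/d(x,y)`. -/
noncomputable def gradAbs (w : V → V → ℝ) (d : V → V → ℝ) (f : V → ℝ) (x : V) : ℝ :=
  sSup {c | ∃ y, 0 < w x y ∧ c = |f y - f x| / d x y}

/-- Recurrence: for every `ε > 0` there is a finitely supported `f` with
`‖f‖∞ = 1` and `-⟨f, Δf⟩ < ε`. -/
def Recurrent (w : V → V → ℝ) (m : V → ℝ) : Prop :=
  ∀ ε : ℝ, 0 < ε → ∃ f : V → ℝ, (Function.support f).Finite ∧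
    (∀ x, |f x| ≤ 1) ∧ (∃ x, |f x| = 1) ∧
    -(∑ᶠ x, f x * lap w m f x * m x) < ε

open Classical in
/-- `∑_{x,y : f(y) < 0 ≤ f(x)} w(x,y)(f(x)-f(y))`. -/
noncomputable def cutSum (w : V → V → ℝ) (f : V → ℝ) : ℝ :=
  ∑ᶠ p : V × V, if f p.2 < 0 ∧ 0 ≤ f p.1 then w p.1 p.2 * (f p.1 - f p.2) else 0

/-- Subexponential growth: `max_{B_r(x)} |u| = e^{o(r)}` as `r → ∞`. -/
def SubexpGrowth (d : V → V → ℝ) (x : V) (u : V → ℝ) : Prop :=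
  Filter.Tendsto
    (fun r : ℕ => Real.log (sSup {c | ∃ y, d x y ≤ (r : ℝ) ∧ c = |u y|}) / (r : ℝ))
    Filter.atTop (nhds 0)


/-- A monotone map of `ι → ℝ` commuting with the addition of constants, whose values have
uniformly bounded oscillation, has an additive eigenvector. -/
theorem exists_additive_eigenvector {ι : Type*} [Fintype ι] [Nonempty ι]
    (T : (ι → ℝ) → ι → ℝ) (hmono : Monotone T)
    (hadd : ∀ f c x, T (fun y => f y + c) x = T f x + c) (D : ℝ)
    (hD : ∀ f x y, T f x - T f y ≤ D) : ∃ f c, ∀ x, T f x = f x + c := by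
  obtain ⟨k⟩ := ‹Nonempty ι›
  have hD0 : 0 ≤ D := by simpa using hD 0 k k
  have habs : ∀ f x y, |T f x - T f y| ≤ D := fun f x y =>
    abs_sub_le_iff.2 ⟨hD f x y, hD f y x⟩
  have hle : ∀ f g x, T f x - T g x ≤ dist f g := by
    intro f g x
    have h1 : f ≤ fun y => g y + dist f g := by
      intro y
      have := (abs_le.1 (dist_le_pi_dist f g y)).2
      linarith
    have := hmono h1 x
    rw [hadd] at this
    linarith
  have hlip : ∀ f g, dist (T f) (T g) ≤ dist f g := by
    intro f g
    refine (dist_pi_le_iff dist_nonneg).2 fun x => abs_sub_le_iff.2 ⟨hle f g x, ?_⟩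
    rw [dist_comm f g]
    exact hle g f x
  have hcont : Continuous T :=
    (LipschitzWith.of_dist_le_mul (K := 1) (by simpa using hlip)).continuous
  have happrox : ∀ δ : ℝ, 0 < δ → δ < 1 → ∃ g : ι → ℝ, (∀ x, |g x| ≤ D) ∧
      ∀ x, |(T g x - g x) - (T g k - g k)| ≤ δ * D := by
    intro δ h0 h1
    have hc : ContractingWith (1 - δ).toNNReal (fun f => (1 - δ) • T f) := by
      refine ⟨by rw [Real.toNNReal_lt_one]; linarith, LipschitzWith.of_dist_le_mul ?_⟩
      intro f g
      rw [dist_smul₀, Real.norm_of_nonneg (by linarith), Real.coe_toNNReal _ (by linarith)]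
      exact mul_le_mul_of_nonneg_left (hlip f g) (by linarith)
    obtain ⟨f, hf⟩ : ∃ f, (1 - δ) • T f = f := ⟨_, hc.fixedPoint_isFixedPt⟩
    have hfx : ∀ x, f x = (1 - δ) * T f x := fun x => by
      conv_lhs => rw [← hf]
      simp
    refine ⟨fun y => f y + -f k, fun x => ?_, fun x => ?_⟩
    · have : f x + -f k = (1 - δ) * (T f x - T f k) := by rw [hfx x, hfx k]; ring
      beta_reduce
      rw [this, abs_mul, abs_of_nonneg (by linarith : 0 ≤ 1 - δ)]
      nlinarith [habs f x k, abs_nonneg (T f x - T f k)]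
    · rw [hadd, hadd]
      have : T f x + -f k - (f x + -f k) - (T f k + -f k - (f k + -f k)) =
          δ * (T f x - T f k) := by
        have h2 := hfx x
        have h3 := hfx k
        linear_combination -h2 + h3
      rw [this, abs_mul, abs_of_pos h0]
      exact mul_le_mul_of_nonneg_left (habs f x k) h0.le
  let Ψ : (ι → ℝ) → ℝ := fun g => ∑ x, |(T g x - g x) - (T g k - g k)|
  have hΨ : Continuous Ψ := by
    have hTx : ∀ x, Continuous fun g => T g x := fun x => (continuous_apply x).comp hcont
    refine continuous_finsetSum _ fun x _ => ?_
    exact (((hTx x).sub (continuous_apply x)).sub ((hTx k).sub (continuous_apply k))).abs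
  obtain ⟨f, -, hf⟩ := (isCompact_Icc (a := fun _ : ι => -D) (b := fun _ => D)).exists_isMinOn
    ⟨0, fun _ => by simpa using hD0, fun _ => by simpa using hD0⟩ hΨ.continuousOn
  have hsmall : Ψ f ≤ 0 := by
    refine le_of_forall_pos_le_add fun ε hε => ?_
    set B : ℝ := Fintype.card ι * D with hB
    have hB0 : 0 ≤ B := by positivity
    have hδ : 0 < ε / (B + ε + 1) := by positivity
    obtain ⟨g, hg1, hg2⟩ := happrox (ε / (B + ε + 1)) hδ
      (by rw [div_lt_one (by positivity)]; linarith)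
    have hmin : Ψ f ≤ Ψ g := hf ⟨fun x => (abs_le.1 (hg1 x)).1, fun x => (abs_le.1 (hg1 x)).2⟩
    have hsum : Ψ g ≤ ε / (B + ε + 1) * B := by
      refine (Finset.sum_le_sum fun x _ => hg2 x).trans_eq ?_
      simp [hB]
      ring
    have : ε / (B + ε + 1) * B ≤ ε := by
      rw [div_mul_eq_mul_div, div_le_iff₀ (by positivity)]
      nlinarith
    linarith
  refine ⟨f, T f k - f k, fun x => ?_⟩
  have h1 : |(T f x - f x) - (T f k - f k)| ≤ Ψ f :=
    Finset.single_le_sum (f := fun x => |(T f x - f x) - (T f k - f k)|)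
      (fun _ _ => abs_nonneg _) (Finset.mem_univ x)
  have := abs_eq_zero.1 (le_antisymm (h1.trans hsmall) (abs_nonneg _))
  linarith

section GraphBase

variable {w : V → V → ℝ} {m : V → ℝ} {d : V → V → ℝ}

theorem lap_eq_sum (hG : IsGraphBase w m d) (f : V → ℝ) (x : V) {N : Finset V}
    (hN : ∀ y, 0 < w x y → y ∈ N) :
    lap w m f x = (m x)⁻¹ * ∑ y ∈ N, w x y * (f y - f x) := by
  obtain ⟨-, -, hnn, -⟩ := hG
  rw [lap, finsum_eq_sum_of_support_subset]
  intro y hy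
  refine hN y (lt_of_le_of_ne (hnn x y) fun h => hy ?_)
  simp [← h]

theorem exists_finset_neighbors (hG : IsGraphBase w m d) (x : V) :
    ∃ N : Finset V, ∀ y, 0 < w x y ↔ y ∈ N := by
  obtain ⟨-, -, -, -, -, hloc, -⟩ := hG
  exact ⟨(hloc x).toFinset, fun y => by simp⟩

theorem lap_neg (hG : IsGraphBase w m d) (f : V → ℝ) (x : V) :
    lap w m (fun y => -f y) x = -lap w m f x := by
  obtain ⟨N, hN⟩ := exists_finset_neighbors hG x
  rw [lap_eq_sum hG _ x fun y => (hN y).1, lap_eq_sum hG _ x fun y => (hN y).1,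
    ← mul_neg, ← Finset.sum_neg_distrib]
  congr 1
  exact Finset.sum_congr rfl fun y _ => by ring

theorem pathLens_nonempty (hG : IsGraphBase w m d) (x y : V) : (pathLens w d x y).Nonempty := by
  obtain ⟨-, -, -, -, -, -, hconn, -⟩ := hG
  induction hconn x y using Relation.ReflTransGen.head_induction_on with
  | refl => exact ⟨_, 0, fun _ => y, rfl, rfl, by simp, rfl⟩
  | @head a b hab _ ih =>
    obtain ⟨_, n, p, hp0, hpn, hp, -⟩ := ih
    refine ⟨_, n + 1, fun i => Nat.casesOn i a p, rfl, hpn, fun i hi => ?_, rfl⟩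
    cases i with
    | zero => simpa [hp0] using hab
    | succ i => exact hp i (by omega)

theorem sub_le_path_length {f : V → ℝ} (hf : ∀ x y, 0 < w x y → f y - f x ≤ d x y)
    (n : ℕ) (p : ℕ → V) (hp : ∀ i < n, 0 < w (p i) (p (i + 1))) :
    f (p n) - f (p 0) ≤ ∑ i ∈ Finset.range n, d (p i) (p (i + 1)) := by
  rw [← Finset.sum_range_sub fun i => f (p i)]
  exact Finset.sum_le_sum fun i hi => hf _ _ (hp i (Finset.mem_range.1 hi))

/-- For a path metric, the Lipschitz condition may be checked along edges. -/
theorem lip1_of_edges (hG : IsGraphBase w m d) {f : V → ℝ}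
    (hf : ∀ x y, 0 < w x y → f y - f x ≤ d x y) : Lip1 d f := by
  intro x y
  have hne := pathLens_nonempty hG x y
  obtain ⟨-, -, -, -, -, -, -, ⟨-, -, -, -, hpath⟩, -⟩ := hG
  rw [hpath x y]
  refine le_csInf hne ?_
  rintro _ ⟨n, p, rfl, rfl, hp, rfl⟩
  exact sub_le_path_length hf n p hp

theorem exists_geodesic_neighbor (hG : IsGraphBase w m d) {x y : V} (hxy : x ≠ y) :
    ∃ z, 0 < w x z ∧ d x y = d x z + d z y := by
  obtain ⟨N, hN⟩ := exists_finset_neighbors hG x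
  have hne := pathLens_nonempty hG x y
  obtain ⟨-, -, -, -, -, -, -, ⟨hd0, -, -, htri, hpath⟩, -⟩ := hG
  have hstep : ∀ L ∈ pathLens w d x y, ∃ z ∈ N, d x z + d z y ≤ L := by
    rintro _ ⟨n, p, rfl, rfl, hp, rfl⟩
    obtain _ | n := n
    · exact absurd rfl hxy
    refine ⟨p 1, (hN _).1 (hp 0 (by omega)), ?_⟩
    rw [Finset.sum_range_succ', add_comm]
    have := sub_le_path_length (w := w) (d := d) (f := fun v => d (p 1) v)
      (fun a b _ => by linarith [htri (p 1) a b]) n (fun i => p (i + 1))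
      fun i hi => hp (i + 1) (by omega)
    simp only [zero_add, hd0, sub_zero] at this ⊢
    linarith
  obtain ⟨z₀, hz₀, -⟩ := hstep _ hne.some_mem
  obtain ⟨z, hz, hmin⟩ := N.exists_min_image (fun z => d x z + d z y) ⟨z₀, hz₀⟩
  refine ⟨z, (hN z).2 hz, le_antisymm (htri _ _ _) ?_⟩
  rw [hpath x y]
  refine le_csInf hne fun L hL => ?_
  obtain ⟨z', hz', h⟩ := hstep L hL
  exact (hmin z' hz').trans h

theorem lap_le_of_adj_of_tight (hG : IsGraphBase w m d) (hκ : NonnegCurv w m d) {f : V → ℝ}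
    (hf : Lip1 d f) {x y : V} (hxy : 0 < w x y) (h : f y - f x = d x y) :
    lap w m f y ≤ lap w m f x := by
  obtain ⟨Nx, hNx⟩ := exists_finset_neighbors hG x
  obtain ⟨Ny, hNy⟩ := exists_finset_neighbors hG y
  have hκ' := hκ x y hxy
  have hlapx := fun f => lap_eq_sum hG f x fun y => (hNx y).1
  have hlapy := fun f => lap_eq_sum hG f y fun z => (hNy z).1
  obtain ⟨-, -, hnn, hdiag, hm, -, -, ⟨-, hpos, hsymm, -, -⟩, -⟩ := hG
  have hne : x ≠ y := by
    rintro rfl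
    exact hxy.ne' (hdiag x)
  rw [kappa] at hκ'
  have hinf := nonneg_of_mul_nonneg_right hκ' (inv_pos.2 (hpos x y hne))
  have hbdd : BddBelow {c | ∃ f : V → ℝ, Lip1 d f ∧ f y - f x = d x y ∧
      c = lap w m f x - lap w m f y} := by
    refine ⟨(m x)⁻¹ * ∑ z ∈ Nx, w x z * (-d x z) - (m y)⁻¹ * ∑ z ∈ Ny, w y z * d y z, ?_⟩
    rintro _ ⟨g, hg, -, rfl⟩
    rw [hlapx, hlapy]
    refine sub_le_sub ?_ ?_ <;>
      refine mul_le_mul_of_nonneg_left (Finset.sum_le_sum fun z _ =>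
        mul_le_mul_of_nonneg_left ?_ (hnn _ _)) (inv_pos.2 (hm _)).le
    · linarith [hg z x, hsymm x z]
    · exact hg y z
  have := csInf_le hbdd ⟨f, hf, h, rfl⟩
  linarith

/-- Non-negative curvature on edges compares the Laplacian along arbitrary pairs on which a
Lipschitz function is extremal. -/
theorem lap_le_of_tight (hG : IsGraphBase w m d) (hκ : NonnegCurv w m d) {f : V → ℝ}
    (hf : Lip1 d f) {x y : V} (h : f y - f x = d x y) : lap w m f y ≤ lap w m f x := by
  have hball : ∀ R, {z | d y z ≤ R}.Finite := by
    obtain ⟨-, -, -, -, -, -, -, -, hfin⟩ := hG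
    exact hfin y
  induction hn : (hball (d y x)).toFinset.card using Nat.strong_induction_on generalizing x with
  | _ n ih =>
  by_cases hxy : x = y
  · rw [hxy]
  obtain ⟨z, hz, hdz⟩ := exists_geodesic_neighbor hG hxy
  have h1 := hf x z
  have h2 := hf z y
  refine (ih _ ?_ (x := z) (by linarith) rfl).trans
    (lap_le_of_adj_of_tight hG hκ hf hz (by linarith))
  obtain ⟨-, -, -, hdiag, -, -, -, ⟨-, hpos, hsymm, -, -⟩, -⟩ := hG
  have hxz : x ≠ z := by
    rintro rfl
    exact hz.ne' (hdiag x)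
  have hlt : d y z < d y x := by
    rw [hsymm y z, hsymm y x]
    linarith [hpos x z hxz]
  rw [← hn]
  refine Finset.card_lt_card ⟨fun v hv => ?_, fun hsub => ?_⟩
  · simp only [Set.Finite.mem_toFinset, Set.mem_ofPred_eq] at hv ⊢
    linarith
  · have := @hsub x (by simp)
    simp only [Set.Finite.mem_toFinset, Set.mem_ofPred_eq] at this
    linarith

theorem lap_add_const (f : V → ℝ) (c : ℝ) (x : V) :
    lap w m (fun y => f y + c) x = lap w m f x := by
  simp only [lap, add_sub_add_right_eq_sub]

/-- The lazy averaging operator `id + ε Δ` is monotone when `ε` is at most the inverse degree. -/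
theorem add_mul_lap_mono (hG : IsGraphBase w m d) {ε : ℝ} (hε : 0 ≤ ε) {x : V}
    (hεx : ε * deg w m x ≤ 1) {f g : V → ℝ} (hfg : f ≤ g) :
    f x + ε * lap w m f x ≤ g x + ε * lap w m g x := by
  obtain ⟨N, hN⟩ := exists_finset_neighbors hG x
  rw [lap_eq_sum hG f x fun y => (hN y).1, lap_eq_sum hG g x fun y => (hN y).1]
  obtain ⟨-, -, hnn, -, hm, -⟩ := hG
  have hdeg : deg w m x = (m x)⁻¹ * ∑ y ∈ N, w x y := by
    rw [deg, finsum_eq_sum_of_support_subset]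
    intro y hy
    exact (hN y).1 (lt_of_le_of_ne (hnn x y) (Ne.symm hy))
  rw [hdeg] at hεx
  have hsum : ∑ y ∈ N, w x y * (f y - f x) + ∑ y ∈ N, w x y * f x ≤
      ∑ y ∈ N, w x y * (g y - g x) + ∑ y ∈ N, w x y * g x := by
    rw [← Finset.sum_add_distrib, ← Finset.sum_add_distrib]
    refine Finset.sum_le_sum fun y _ => ?_
    have := mul_le_mul_of_nonneg_left (hfg y) (hnn x y)
    linarith
  rw [← Finset.sum_mul, ← Finset.sum_mul] at hsum
  have h1 := mul_le_mul_of_nonneg_left hsum (mul_nonneg hε (inv_pos.2 (hm x)).le)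
  have h2 := mul_le_mul_of_nonneg_left (hfg x) (sub_nonneg.2 hεx)
  linear_combination h1 + h2

theorem exists_pos_mul_deg_le_one (hG : IsGraphBase w m d) {K : Set V} (hK : K.Finite) :
    ∃ ε : ℝ, 0 < ε ∧ ∀ x ∈ K, ε * deg w m x ≤ 1 := by
  have hdeg : ∀ x, 0 ≤ deg w m x := by
    obtain ⟨-, -, hnn, -, hm, -⟩ := hG
    exact fun x => mul_nonneg (inv_pos.2 (hm x)).le (finsum_nonneg fun y => hnn x y)
  have hs : 0 ≤ ∑ x ∈ hK.toFinset, deg w m x := Finset.sum_nonneg fun x _ => hdeg x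
  refine ⟨(1 + ∑ x ∈ hK.toFinset, deg w m x)⁻¹, by positivity, fun x hx => ?_⟩
  rw [inv_mul_le_iff₀ (by positivity)]
  have := Finset.single_le_sum (fun x _ => hdeg x) (hK.mem_toFinset.2 hx)
  linarith

end GraphBase

open Classical in
/-- The extremal Lipschitz extension of a function on `K`: minimal on `X`, maximal off `X`. -/
noncomputable def lipExt (d : V → V → ℝ) (X K : Set V) (f : K → ℝ) (v : V) : ℝ :=
  if v ∈ X then ⨆ u : K, (f u - d v u) else ⨅ u : K, (f u + d v u)

section LipExt

variable {w : V → V → ℝ} {m : V → ℝ} {d : V → V → ℝ} {X Y K : Set V} [Finite K]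

theorem le_lipExt (f : K → ℝ) {v : V} (hv : v ∈ X) (u : K) :
    f u - d v u ≤ lipExt d X K f v := by
  rw [lipExt, if_pos hv]
  exact le_ciSup (f := fun u : K => f u - d v u) (Set.finite_range _).bddAbove u

theorem lipExt_le (f : K → ℝ) {v : V} (hv : v ∉ X) (u : K) :
    lipExt d X K f v ≤ f u + d v u := by
  rw [lipExt, if_neg hv]
  exact ciInf_le (f := fun u : K => f u + d v u) (Set.finite_range _).bddBelow u

variable [Nonempty K]

theorem exists_lipExt_eq_sub (f : K → ℝ) {v : V} (hv : v ∈ X) :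
    ∃ u : K, lipExt d X K f v = f u - d v u := by
  rw [lipExt, if_pos hv]
  obtain ⟨u, hu⟩ := exists_eq_ciSup_of_finite (f := fun u : K => f u - d v u)
  exact ⟨u, hu.symm⟩

theorem exists_lipExt_eq_add (f : K → ℝ) {v : V} (hv : v ∉ X) :
    ∃ u : K, lipExt d X K f v = f u + d v u := by
  rw [lipExt, if_neg hv]
  obtain ⟨u, hu⟩ := exists_eq_ciInf_of_finite (f := fun u : K => f u + d v u)
  exact ⟨u, hu.symm⟩

theorem lipExt_mono : Monotone (lipExt d X K) := by
  intro f g hfg v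
  by_cases hv : v ∈ X
  · obtain ⟨u, hu⟩ := exists_lipExt_eq_sub (d := d) f hv
    linarith [hfg u, le_lipExt (d := d) g hv u]
  · obtain ⟨u, hu⟩ := exists_lipExt_eq_add (d := d) g hv
    linarith [hfg u, lipExt_le (d := d) f hv u]

theorem lipExt_add_const (f : K → ℝ) (c : ℝ) :
    lipExt d X K (fun u => f u + c) = fun v => lipExt d X K f v + c := by
  have hle : ∀ (g : K → ℝ) (b : ℝ) (v : V),
      lipExt d X K (fun u => g u + b) v ≤ lipExt d X K g v + b := by
    intro g b v
    by_cases hv : v ∈ X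
    · obtain ⟨u, hu⟩ := exists_lipExt_eq_sub (d := d) (fun u => g u + b) hv
      linarith [le_lipExt (d := d) g hv u]
    · obtain ⟨u, hu⟩ := exists_lipExt_eq_add (d := d) g hv
      have := lipExt_le (d := d) (fun u => g u + b) hv u
      linarith
  funext v
  refine le_antisymm (hle f c v) ?_
  have := hle (fun u => f u + c) (-c) v
  simp only [add_neg_cancel_right] at this
  linarith

theorem lipExt_eq_self (hd0 : ∀ x, d x x = 0) (hXK : Disjoint X K) {f : K → ℝ}
    (hf : ∀ u v : K, f v - f u ≤ d v u) (k : K) : lipExt d X K f k = f k := by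
  have hk : (k : V) ∉ X := fun h => Set.disjoint_left.1 hXK h k.2
  refine le_antisymm (by simpa [hd0] using lipExt_le (d := d) f hk k) ?_
  obtain ⟨u, hu⟩ := exists_lipExt_eq_add (d := d) f hk
  linarith [hf u k]

theorem lip1_lipExt (hG : IsGraphBase w m d) (hP : SalamiPartition w m X Y K) {f : K → ℝ}
    (hf : ∀ u v : K, f v - f u ≤ d v u) : Lip1 d (lipExt d X K f) := by
  refine lip1_of_edges hG fun x y hxy => ?_
  obtain ⟨-, hws, -, -, -, -, -, ⟨hd0, -, hsymm, htri, -⟩, -⟩ := hG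
  obtain ⟨huniv, -, hXK, -, -, hXY, -⟩ := hP
  have hK : ∀ {x y}, 0 < w x y → x ∈ X → y ∉ X → y ∈ K := by
    intro x y hxy hx hy
    rcases huniv.symm.subset (Set.mem_univ y) with (h | h) | h
    · exact absurd h hy
    · exact absurd (hXY x hx y h) hxy.ne'
    · exact h
  by_cases hx : x ∈ X <;> by_cases hy : y ∈ X
  · obtain ⟨u, hu⟩ := exists_lipExt_eq_sub (d := d) f hy
    linarith [le_lipExt (d := d) f hx u, htri x y u]
  · have h1 := lipExt_eq_self (K := K) hd0 hXK hf ⟨y, hK hxy hx hy⟩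
    have h2 := le_lipExt (d := d) f hx ⟨y, hK hxy hx hy⟩
    simp only at h1 h2
    linarith
  · obtain ⟨u, hu⟩ := exists_lipExt_eq_sub (d := d) f hy
    have hxK := hK (hws x y ▸ hxy) hy hx
    have h1 := lipExt_eq_self (K := K) hd0 hXK hf ⟨x, hxK⟩
    have h2 := hf ⟨x, hxK⟩ u
    simp only at h1 h2
    linarith [htri u y x, hsymm u y, hsymm x y]
  · obtain ⟨u, hu⟩ := exists_lipExt_eq_add (d := d) f hx
    linarith [lipExt_le (d := d) f hy u, htri y x u, hsymm x y]

/-- Some extremal Lipschitz extension has constant Laplacian on `K`. -/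
theorem exists_lap_lipExt_eq_const (hG : IsGraphBase w m d) (hκ : NonnegCurv w m d)
    (hP : SalamiPartition w m X Y K) :
    ∃ (f : K → ℝ) (c : ℝ), (∀ u v : K, f v - f u ≤ d v u) ∧
      ∀ k : K, lap w m (lipExt d X K f) k = c := by
  obtain ⟨ε, hε, hεK⟩ := exists_pos_mul_deg_le_one hG (Set.toFinite K)
  let F : (K → ℝ) → K → ℝ := fun f u => lipExt d X K f u + ε * lap w m (lipExt d X K f) u
  let T : (K → ℝ) → K → ℝ := fun f x => ⨅ u : K, (F f u + d x u)
  have hTle : ∀ f x u, T f x ≤ F f u + d x u := fun f x u =>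
    ciInf_le (f := fun u : K => F f u + d x u) (Set.finite_range _).bddBelow u
  have hTex : ∀ f x, ∃ u, T f x = F f u + d x u := fun f x => by
    obtain ⟨u, hu⟩ := exists_eq_ciInf_of_finite (f := fun u : K => F f u + d x u)
    exact ⟨u, hu.symm⟩
  have hFmono : Monotone F := fun f g hfg u =>
    add_mul_lap_mono hG hε.le (hεK u u.2) (lipExt_mono hfg)
  have hFadd : ∀ f c u, F (fun y => f y + c) u = F f u + c := fun f c u => by
    simp only [F, lipExt_add_const, lap_add_const]
    ring
  have htri : ∀ x y z, d x z ≤ d x y + d y z := by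
    obtain ⟨-, -, -, -, -, -, -, ⟨-, -, -, htri, -⟩, -⟩ := hG
    exact htri
  have hTlip : ∀ f x y, T f x - T f y ≤ d x y := fun f x y => by
    obtain ⟨u, hu⟩ := hTex f y
    linarith [hTle f x u, htri x y u]
  have hTmono : Monotone T := fun f g hfg x => by
    obtain ⟨u, hu⟩ := hTex g x
    linarith [hTle f x u, hFmono hfg u]
  have hTadd : ∀ f c x, T (fun y => f y + c) x = T f x + c := fun f c x => by
    obtain ⟨u, hu⟩ := hTex f x
    obtain ⟨v, hv⟩ := hTex (fun y => f y + c) x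
    have h1 := hTle (fun y => f y + c) x u
    have h2 := hTle f x v
    rw [hFadd] at hv h1
    linarith
  obtain ⟨D, hD⟩ := (Set.finite_range fun p : K × K => d p.1 p.2).bddAbove
  have := Fintype.ofFinite K
  obtain ⟨f, c, hfc⟩ := exists_additive_eigenvector T hTmono hTadd D fun f x y =>
    (hTlip f x y).trans (hD ⟨(x, y), rfl⟩)
  have hlip : ∀ u v : K, f v - f u ≤ d v u := fun u v => by
    linarith [hTlip f v u, hfc u, hfc v]
  have hLip := lip1_lipExt hG hP hlip
  have htight := @lap_le_of_tight V w m d hG hκ _ hLip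
  obtain ⟨-, -, -, -, -, -, -, ⟨hd0, -, hsymm, -, -⟩, -⟩ := hG
  obtain ⟨-, -, hXK, -⟩ := hP
  have hself := lipExt_eq_self (X := X) (K := K) hd0 hXK hlip
  refine ⟨f, c / ε, hlip, fun k => ?_⟩
  have hF : ∀ u, F f u = f u + ε * lap w m (lipExt d X K f) u := fun u => by
    simp only [F, hself]
  have hge : ∀ u : K, c ≤ ε * lap w m (lipExt d X K f) u := fun u => by
    have := hTle f u u
    rw [hF, hfc, hd0] at this
    linarith
  rw [eq_div_iff hε.ne', mul_comm]
  refine le_antisymm ?_ (hge k)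
  obtain ⟨u, hu⟩ := hTex f k
  rw [hF, hfc] at hu
  have h1 := hge u
  have h2 := hlip u k
  have h3 := htight (x := u) (y := k) (by rw [hself, hself, hsymm u k]; linarith)
  have h4 := mul_le_mul_of_nonneg_left h3 hε.le
  linarith

end LipExt

theorem sum_sum_mul_sub_mul_sub {w : V → V → ℝ} (hw : ∀ x y, w x y = w y x) (N : Finset V)
    (u F : V → ℝ) :
    ∑ x ∈ N, ∑ y ∈ N, w x y * ((u x - u y) * (F x - F y)) =
      -2 * ∑ x ∈ N, u x * ∑ y ∈ N, w x y * (F y - F x) := by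
  have h : ∑ x ∈ N, ∑ y ∈ N, w x y * (u y * (F x - F y)) =
      ∑ x ∈ N, ∑ y ∈ N, w x y * (u x * (F y - F x)) := by
    rw [Finset.sum_comm]
    exact Finset.sum_congr rfl fun x _ => Finset.sum_congr rfl fun y _ => by rw [hw]
  have h1 : ∑ x ∈ N, u x * ∑ y ∈ N, w x y * (F y - F x) =
      ∑ x ∈ N, ∑ y ∈ N, w x y * (u x * (F y - F x)) := by
    refine Finset.sum_congr rfl fun x _ => ?_
    rw [Finset.mul_sum]
    exact Finset.sum_congr rfl fun y _ => by ring
  have h2 : ∑ x ∈ N, ∑ y ∈ N, w x y * ((u x - u y) * (F x - F y)) =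
      -(∑ x ∈ N, ∑ y ∈ N, w x y * (u x * (F y - F x))) -
        ∑ x ∈ N, ∑ y ∈ N, w x y * (u y * (F x - F y)) := by
    simp only [← Finset.sum_neg_distrib, ← Finset.sum_sub_distrib]
    exact Finset.sum_congr rfl fun x _ => Finset.sum_congr rfl fun y _ => by ring
  rw [h2, h, h1]
  ring

open Classical in
/-- The function equal to `1` off `X` which decreases on `X` with slope `1 / R` in the values of
`F` below `-M`, until it vanishes. -/
noncomputable def cutoff (X : Set V) (F : V → ℝ) (M R : ℝ) (x : V) : ℝ :=
  if x ∈ X then max 0 (min 1 (1 + (F x + M) / R)) else 1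

section Cutoff

variable {w : V → V → ℝ} {m : V → ℝ} {d : V → V → ℝ} {X : Set V} {F : V → ℝ} {M R : ℝ}

theorem cutoff_of_notMem {x : V} (hx : x ∉ X) : cutoff X F M R x = 1 := if_neg hx

theorem cutoff_nonneg (x : V) : 0 ≤ cutoff X F M R x := by
  rw [cutoff]
  split_ifs
  · exact le_max_left _ _
  · exact zero_le_one

theorem cutoff_le_one (x : V) : cutoff X F M R x ≤ 1 := by
  rw [cutoff]
  split_ifs
  · exact max_le zero_le_one (min_le_left _ _)
  · exact le_rfl

theorem cutoff_eq_one (hR : 0 < R) {x : V} (hx : -M ≤ F x) : cutoff X F M R x = 1 := by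
  rw [cutoff]
  split_ifs
  · rw [min_eq_left, max_eq_right zero_le_one]
    have : 0 ≤ (F x + M) / R := div_nonneg (by linarith) hR.le
    linarith
  · rfl

theorem le_of_cutoff_ne_zero (hR : 0 < R) {x : V} (hx : x ∈ X) (h : cutoff X F M R x ≠ 0) :
    -M - R ≤ F x := by
  by_contra! hlt
  refine h ?_
  rw [cutoff, if_pos hx, max_eq_left]
  refine (min_le_right _ _).trans ?_
  have : (F x + M) / R ≤ -1 := by
    rw [div_le_iff₀ hR]
    linarith
  linarith

theorem mul_sq_max_min_sub_le (hR : 0 < R) (s t : ℝ) :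
    R * (max 0 (min 1 (1 + (s + M) / R)) - max 0 (min 1 (1 + (t + M) / R))) ^ 2 ≤
      (max 0 (min 1 (1 + (s + M) / R)) - max 0 (min 1 (1 + (t + M) / R))) * (s - t) := by
  wlog hst : t ≤ s generalizing s t
  · have := this t s (le_of_not_ge hst)
    linarith
  set a := (s + M) / R with ha
  set b := (t + M) / R with hb
  have hab : R * (a - b) = s - t := by
    rw [ha, hb]
    field_simp
    ring
  have hle : b ≤ a := by
    rw [ha, hb]
    gcongr
  have h0 : 0 ≤ max 0 (min 1 (1 + a)) - max 0 (min 1 (1 + b)) :=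
    sub_nonneg.2 (by gcongr)
  have h1 : max 0 (min 1 (1 + a)) - max 0 (min 1 (1 + b)) ≤ a - b := by
    grind
  rw [← hab]
  nlinarith [mul_le_mul_of_nonneg_left h1 (mul_nonneg hR.le h0)]

theorem mul_sq_cutoff_sub_le (hR : 0 < R)
    {x y : V} (hx : y ∈ X → x ∉ X → -M ≤ F x) (hy : x ∈ X → y ∉ X → -M ≤ F y) :
    R * (cutoff X F M R x - cutoff X F M R y) ^ 2 ≤
      (cutoff X F M R x - cutoff X F M R y) * (F x - F y) := by
  by_cases h : x ∉ X ∧ y ∉ X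
  · simp [cutoff_of_notMem h.1, cutoff_of_notMem h.2]
  have hform : ∀ z, (z ∉ X → -M ≤ F z) →
      cutoff X F M R z = max 0 (min 1 (1 + (F z + M) / R)) := by
    intro z hz
    by_cases hzX : z ∈ X
    · rw [cutoff, if_pos hzX]
    · have h1 := cutoff_eq_one (X := Set.univ) hR (hz hzX)
      rw [cutoff, if_pos (Set.mem_univ z)] at h1
      rw [cutoff_of_notMem hzX, h1]
  rw [hform x (by tauto), hform y (by tauto)]
  exact mul_sq_max_min_sub_le hR _ _

open Classical in
/-- Green's formula on `X`: if `ΔF ≥ c` on `X`, then the energy and the mass of the cutoffs are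
controlled by the flux of `F` through the boundary of `X`. -/
theorem exists_energy_add_mass_le (hG : IsGraphBase w m d) {c : ℝ} (hc : 0 ≤ c)
    (hfin : ∀ t, {x | x ∈ X ∧ t ≤ F x}.Finite)
    (hbdry : {x | x ∉ X ∧ ∃ y ∈ X, 0 < w x y}.Finite)
    (hlap : ∀ x ∈ X, c ≤ lap w m F x) :
    ∃ C : ℝ, ∀ M R : ℝ, 0 < R → (∀ x ∉ X, (∃ y ∈ X, 0 < w x y) → -M ≤ F x) →
      ∀ N : Finset V,
        R * ∑ x ∈ N, ∑ y ∈ N, w x y * (cutoff X F M R x - cutoff X F M R y) ^ 2 +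
          2 * c * ∑ x ∈ N, (if x ∈ X then cutoff X F M R x * m x else 0) ≤ C := by
  choose nb hnb using exists_finset_neighbors hG
  have hlapsum := fun x => fun N : Finset V => lap_eq_sum hG F x (N := N)
  obtain ⟨-, hws, hnn, -, hm, -⟩ := hG
  let v : V → ℝ := fun x => if x ∈ X then 0 else 1
  let a : V → V → ℝ := fun x y => w x y * ((v x - v y) * (F x - F y))
  let B := hbdry.toFinset
  let P : Finset (V × V) := B.biUnion fun x => (nb x).biUnion fun y => {(x, y), (y, x)}
  have haP : ∀ p : V × V, p ∉ P → a p.1 p.2 = 0 := by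
    rintro ⟨x, y⟩ hp
    by_contra ha
    refine hp ?_
    have hw : 0 < w x y := lt_of_le_of_ne (hnn x y) fun h => ha (by simp [a, ← h])
    have hmem : ∀ {x y : V}, x ∉ X → y ∈ X → 0 < w x y → (x, y) ∈ P ∧ (y, x) ∈ P := by
      intro x y hx hy hw
      have hxB : x ∈ B := hbdry.mem_toFinset.2 ⟨hx, y, hy, hw⟩
      constructor <;>
        exact Finset.mem_biUnion.2 ⟨x, hxB, Finset.mem_biUnion.2 ⟨y, (hnb x y).1 hw, by simp⟩⟩
    by_cases hx : x ∈ X <;> by_cases hy : y ∈ X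
    · simp [a, v, hx, hy] at ha
    · exact (hmem hy hx (hws x y ▸ hw)).2
    · exact (hmem hx hy hw).1
    · simp [a, v, hx, hy] at ha
  have hflux : ∀ N : Finset V, ∑ x ∈ N, ∑ y ∈ N, a x y ≤ ∑ p ∈ P, |a p.1 p.2| := by
    intro N
    rw [← Finset.sum_product' N N a]
    refine (Finset.sum_le_sum fun p _ => le_abs_self (a p.1 p.2)).trans ?_
    rw [← Finset.sum_filter_of_ne (p := fun p => p ∈ P) fun p _ hp => by
      by_contra h
      exact hp (by simp [haP p h])]
    exact Finset.sum_le_sum_of_subset_of_nonneg (fun p hp => (Finset.mem_filter.1 hp).2)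
      fun p _ _ => abs_nonneg _
  refine ⟨∑ p ∈ P, |a p.1 p.2|, fun M R hR hM N₀ => ?_⟩
  set h := cutoff X F M R with hh
  let u : V → ℝ := fun x => if x ∈ X then h x else 0
  have hu0 : ∀ x, 0 ≤ u x := fun x => by
    simp only [u]
    split_ifs
    exacts [cutoff_nonneg x, le_rfl]
  let S := (hfin (-M - R)).toFinset
  let N := N₀ ∪ S ∪ S.biUnion nb
  have hN₀ : N₀ ⊆ N := fun x hx => by simp [N, hx]
  have hnbN : ∀ x, u x ≠ 0 → ∀ y, 0 < w x y → y ∈ N := by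
    intro x hux y hxy
    have hxX : x ∈ X := by
      by_contra hx
      simp [u, hx] at hux
    have hxS : x ∈ S := (hfin _).mem_toFinset.2
      ⟨hxX, le_of_cutoff_ne_zero hR hxX (by simpa [u, hxX] using hux)⟩
    exact Finset.mem_union_right _ (Finset.mem_biUnion.2 ⟨x, hxS, (hnb x y).1 hxy⟩)
  have hgreen : ∑ x ∈ N, c * (u x * m x) ≤ ∑ x ∈ N, u x * ∑ y ∈ N, w x y * (F y - F x) := by
    refine Finset.sum_le_sum fun x _ => ?_
    by_cases hux : u x = 0
    · simp [hux]
    have hxX : x ∈ X := by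
      by_contra hx
      simp [u, hx] at hux
    have h1 := hlap x hxX
    rw [hlapsum x N (hnbN x hux), ← div_eq_inv_mul, le_div_iff₀ (hm x)] at h1
    have := mul_le_mul_of_nonneg_left h1 (hu0 x)
    linarith
  have henergy : R * ∑ x ∈ N, ∑ y ∈ N, w x y * (h x - h y) ^ 2 ≤
      ∑ x ∈ N, ∑ y ∈ N, w x y * ((u x - u y) * (F x - F y)) + ∑ x ∈ N, ∑ y ∈ N, a x y := by
    simp only [Finset.mul_sum, ← Finset.sum_add_distrib]
    refine Finset.sum_le_sum fun x _ => Finset.sum_le_sum fun y _ => ?_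
    have huv : ∀ x, h x = u x + v x := fun x => by
      by_cases hx : x ∈ X
      · simp [u, v, hx]
      · simp [u, v, hx, hh, cutoff_of_notMem hx]
    obtain hw | hw := (hnn x y).eq_or_lt
    · simp [a, ← hw]
    have := mul_sq_cutoff_sub_le (X := X) (F := F) hR
      (fun hy hx => hM x hx ⟨y, hy, hw⟩) (fun hx hy => hM y hy ⟨x, hx, hws x y ▸ hw⟩)
    rw [← hh] at this
    have h2 := mul_le_mul_of_nonneg_left this hw.le
    simp only [a]
    have h3 : h x - h y = (u x - u y) + (v x - v y) := by
      rw [huv, huv]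
      ring
    calc R * (w x y * (h x - h y) ^ 2) = w x y * (R * (h x - h y) ^ 2) := by ring
      _ ≤ w x y * ((h x - h y) * (F x - F y)) := h2
      _ = _ := by
        rw [h3]
        ring
  rw [sum_sum_mul_sub_mul_sub hws] at henergy
  rw [← Finset.mul_sum] at hgreen
  have hmono1 : ∑ x ∈ N₀, ∑ y ∈ N₀, w x y * (h x - h y) ^ 2 ≤
      ∑ x ∈ N, ∑ y ∈ N, w x y * (h x - h y) ^ 2 := by
    have hpos : ∀ x y, 0 ≤ w x y * (h x - h y) ^ 2 := fun x y =>
      mul_nonneg (hnn x y) (sq_nonneg _)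
    refine (Finset.sum_le_sum fun x _ => Finset.sum_le_sum_of_subset_of_nonneg hN₀
      fun y _ _ => hpos x y).trans ?_
    exact Finset.sum_le_sum_of_subset_of_nonneg hN₀
      fun x _ _ => Finset.sum_nonneg fun y _ => hpos x y
  have hmono2 : ∑ x ∈ N₀, (if x ∈ X then h x * m x else 0) ≤ ∑ x ∈ N, u x * m x := by
    simp only [u, ite_mul, zero_mul]
    refine Finset.sum_le_sum_of_subset_of_nonneg hN₀ fun x _ _ => ?_
    split_ifs
    exacts [mul_nonneg (cutoff_nonneg x) (hm x).le, le_rfl]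
  have h1 := mul_le_mul_of_nonneg_left hmono1 hR.le
  have h2 := mul_le_mul_of_nonneg_left hmono2 hc
  linarith [hflux N]

theorem not_lap_pos_of_infVolume (hG : IsGraphBase w m d)
    (hfin : ∀ t, {x | x ∈ X ∧ t ≤ F x}.Finite)
    (hbdry : {x | x ∉ X ∧ ∃ y ∈ X, 0 < w x y}.Finite) (hvol : InfVolume m X) {c : ℝ}
    (hc : 0 < c) : ¬ ∀ x ∈ X, c ≤ lap w m F x := by
  classical
  intro hlap
  obtain ⟨C, hC⟩ := exists_energy_add_mass_le hG hc.le hfin hbdry hlap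
  obtain ⟨A, hAX, hA⟩ := hvol (C / (2 * c))
  obtain ⟨M, hM⟩ := ((A ∪ hbdry.toFinset).finite_toSet.image fun x => -F x).bddAbove
  have hM' : ∀ x ∈ A ∪ hbdry.toFinset, -M ≤ F x := fun x hx =>
    neg_le.1 (hM (Set.mem_image_of_mem _ hx))
  have hle := hC M 1 one_pos
    (fun x hx hy => hM' x (Finset.mem_union_right _ (hbdry.mem_toFinset.2 ⟨hx, hy⟩))) A
  have hsum : ∑ x ∈ A, (if x ∈ X then cutoff X F M 1 x * m x else 0) = ∑ x ∈ A, m x :=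
    Finset.sum_congr rfl fun x hx => by
      rw [if_pos (hAX hx), cutoff_eq_one one_pos (hM' x (Finset.mem_union_left _ hx)), one_mul]
  have hpos : 0 ≤ ∑ x ∈ A, ∑ y ∈ A, w x y * (cutoff X F M 1 x - cutoff X F M 1 y) ^ 2 := by
    obtain ⟨-, -, hnn, -⟩ := hG
    exact Finset.sum_nonneg fun x _ => Finset.sum_nonneg fun y _ =>
      mul_nonneg (hnn x y) (sq_nonneg _)
  rw [hsum] at hle
  rw [div_lt_iff₀ (by positivity)] at hA
  linarith

theorem exists_cutoff_energy_le (hG : IsGraphBase w m d)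
    (hfin : ∀ t, {x | x ∈ X ∧ t ≤ F x}.Finite)
    (hbdry : {x | x ∉ X ∧ ∃ y ∈ X, 0 < w x y}.Finite) (hlap : ∀ x ∈ X, 0 ≤ lap w m F x)
    {ε : ℝ} (hε : 0 < ε) :
    ∃ h : V → ℝ, (∀ x ∉ X, h x = 1) ∧ (∀ x, 0 ≤ h x) ∧ (∀ x, h x ≤ 1) ∧
      {x | x ∈ X ∧ h x ≠ 0}.Finite ∧
      ∀ N : Finset V, ∑ x ∈ N, ∑ y ∈ N, w x y * (h x - h y) ^ 2 ≤ ε := by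
  classical
  obtain ⟨C, hC⟩ := exists_energy_add_mass_le hG le_rfl hfin hbdry hlap
  obtain ⟨M, hM⟩ := (hbdry.image fun x => -F x).bddAbove
  have hM' : ∀ x ∉ X, (∃ y ∈ X, 0 < w x y) → -M ≤ F x := fun x hx hy =>
    neg_le.1 (hM (Set.mem_image_of_mem _ ⟨hx, hy⟩))
  have hR : 0 < (|C| + 1) / ε := by positivity
  refine ⟨cutoff X F M ((|C| + 1) / ε), fun x hx => cutoff_of_notMem hx, cutoff_nonneg,
    cutoff_le_one, (hfin (-M - (|C| + 1) / ε)).subset fun x hx =>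
      ⟨hx.1, le_of_cutoff_ne_zero hR hx.1 hx.2⟩, fun N => ?_⟩
  have := hC M _ hR hM' N
  rw [mul_zero, zero_mul, add_zero, div_mul_eq_mul_div, div_le_iff₀ hε] at this
  have hCabs := le_abs_self C
  have : (|C| + 1) * ∑ x ∈ N, ∑ y ∈ N, w x y * (cutoff X F M ((|C| + 1) / ε) x -
      cutoff X F M ((|C| + 1) / ε) y) ^ 2 ≤ (|C| + 1) * ε := by
    nlinarith
  exact le_of_mul_le_mul_left this (by positivity)

end Cutoff

section

variable {w : V → V → ℝ} {m : V → ℝ} {d : V → V → ℝ}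

/-- The energy of a finitely supported function as a finite double sum. -/
theorem exists_energy_eq (hG : IsGraphBase w m d) {g : V → ℝ} (hg : g.support.Finite) :
    ∃ N : Finset V, 2 * -(∑ᶠ x, g x * lap w m g x * m x) =
      ∑ x ∈ N, ∑ y ∈ N, w x y * (g x - g y) ^ 2 := by
  classical
  choose nb hnb using exists_finset_neighbors hG
  let S := hg.toFinset
  have hS : ∀ x, g x ≠ 0 → x ∈ S := fun x hx => hg.mem_toFinset.2 hx
  refine ⟨S ∪ S.biUnion nb, ?_⟩
  rw [finsum_eq_sum_of_support_subset (s := S ∪ S.biUnion nb)]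
  · simp only [sq]
    rw [sum_sum_mul_sub_mul_sub hG.2.1, mul_neg, neg_mul]
    congr 2
    refine Finset.sum_congr rfl fun x _ => ?_
    by_cases hx : g x = 0
    · simp [hx]
    rw [lap_eq_sum hG g x (N := S ∪ S.biUnion nb) fun y hxy => Finset.mem_union_right _
      (Finset.mem_biUnion.2 ⟨x, hS x hx, (hnb x y).1 hxy⟩)]
    have := (hG.2.2.2.2.1 x).ne'
    field_simp
  · intro x hx
    refine Finset.mem_coe.2 (Finset.mem_union_left _ (hS x fun h => hx ?_))
    simp [h]

theorem salamiPartition_nonempty (hG : IsGraphBase w m d) {X Y K : Set V}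
    (hP : SalamiPartition w m X Y K) : Nonempty K := by
  obtain ⟨-, -, -, -, -, -, hconn, -⟩ := hG
  obtain ⟨huniv, hdisj, -, -, -, hXY, hX, hY⟩ := hP
  have hne : ∀ {A : Set V}, InfVolume m A → A.Nonempty := by
    intro A hA
    obtain ⟨s, hs, hlt⟩ := hA 0
    obtain ⟨x, hx⟩ : s.Nonempty := Finset.nonempty_iff_ne_empty.2 (by rintro rfl; simp at hlt)
    exact ⟨x, hs hx⟩
  obtain ⟨x, hx⟩ := hne hX
  obtain ⟨y, hy⟩ := hne hY
  by_contra hK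
  have hreach : ∀ z, Relation.ReflTransGen (fun a b => 0 < w a b) x z → z ∈ X := by
    intro z hz
    induction hz with
    | refl => exact hx
    | @tail a b _ hab ih =>
      rcases huniv.symm.subset (Set.mem_univ b) with (h | h) | h
      · exact h
      · exact absurd (hXY a ih b h) hab.ne'
      · exact absurd ⟨b, h⟩ hK
  exact Set.disjoint_left.1 hdisj (hreach y (hconn x y)) hy

end

/-- **Theorem (Recurrence).** Every salami is recurrent. -/
theorem salami_recurrent {V : Type*} (w : V → V → ℝ) (m : V → ℝ) (d : V → V → ℝ)
    (h : IsSalami w m d) :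
    Recurrent w m := by
  obtain ⟨hG, hκ, X, Y, K, hP⟩ := h
  obtain ⟨huniv, hXYd, hXK, hYK, hKfin, hXY, hXvol, hYvol⟩ := id hP
  have hws := hG.2.1
  have hXbdry : ∀ x, x ∉ X → (∃ y ∈ X, 0 < w x y) → x ∈ K := by
    rintro x hx ⟨y, hy, hxy⟩
    rcases huniv.symm.subset (Set.mem_univ x) with (h | h) | h
    · exact absurd h hx
    · exact absurd (hXY y hy x h) (hws x y ▸ hxy.ne')
    · exact h
  have hYbdry : ∀ x, x ∉ Y → (∃ y ∈ Y, 0 < w x y) → x ∈ K := by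
    rintro x hx ⟨y, hy, hxy⟩
    rcases huniv.symm.subset (Set.mem_univ x) with (h | h) | h
    · exact absurd (hXY x h y hy) hxy.ne'
    · exact absurd h hx
    · exact h
  have hXbfin : {x | x ∉ X ∧ ∃ y ∈ X, 0 < w x y}.Finite :=
    hKfin.subset fun x hx => hXbdry x hx.1 hx.2
  have hYbfin : {x | x ∉ Y ∧ ∃ y ∈ Y, 0 < w x y}.Finite :=
    hKfin.subset fun x hx => hYbdry x hx.1 hx.2
  have hKne : Nonempty K := salamiPartition_nonempty hG hP
  have : Finite K := hKfin
  obtain ⟨f, c, hlip, hfc⟩ := exists_lap_lipExt_eq_const hG hκ hP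
  have hball := hG.2.2.2.2.2.2.2.2
  have hd0 := hG.2.2.2.2.2.2.2.1.1
  have hsymm := hG.2.2.2.2.2.2.2.1.2.2.1
  have hself := lipExt_eq_self (X := X) (K := K) hd0 hXK hlip
  have hLip := lip1_lipExt hG hP hlip
  set F := lipExt d X K f with hF
  have hXex : ∀ x ∈ X, ∃ u : K, F x = f u - d x u := fun x hx => exists_lipExt_eq_sub f hx
  have hYex : ∀ x ∈ Y, ∃ u : K, F x = f u + d x u := fun x hx =>
    exists_lipExt_eq_add f fun h => Set.disjoint_left.1 hXYd h hx
  have hXlap : ∀ x ∈ X, c ≤ lap w m F x := fun x hx => by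
    obtain ⟨u, hu⟩ := hXex x hx
    rw [← hfc u]
    exact lap_le_of_tight hG hκ hLip (by rw [hself, hu]; ring)
  have hYlap : ∀ x ∈ Y, lap w m F x ≤ c := fun x hx => by
    obtain ⟨u, hu⟩ := hYex x hx
    rw [← hfc u]
    exact lap_le_of_tight hG hκ hLip (by rw [hself, hu, hsymm]; ring)
  have hXfin : ∀ t, {x | x ∈ X ∧ t ≤ F x}.Finite := fun t => by
    refine (Set.finite_iUnion fun u : K => hball u (f u - t)).subset fun x hx => ?_
    obtain ⟨u, hu⟩ := hXex x hx.1
    refine Set.mem_iUnion.2 ⟨u, ?_⟩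
    have := hx.2
    change d u x ≤ f u - t
    linarith [hsymm u x]
  have hYfin : ∀ t, {x | x ∈ Y ∧ t ≤ -F x}.Finite := fun t => by
    refine (Set.finite_iUnion fun u : K => hball u (-t - f u)).subset fun x hx => ?_
    obtain ⟨u, hu⟩ := hYex x hx.1
    refine Set.mem_iUnion.2 ⟨u, ?_⟩
    have := hx.2
    change d u x ≤ -t - f u
    linarith [hsymm u x]
  have hYlap' : ∀ x ∈ Y, -c ≤ lap w m (fun y => -F y) x := fun x hx => by
    rw [lap_neg hG]
    exact neg_le_neg (hYlap x hx)
  have hc : c = 0 := by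
    rcases lt_trichotomy c 0 with hc | hc | hc
    · exact absurd hYlap' (not_lap_pos_of_infVolume hG hYfin hYbfin hYvol (neg_pos.2 hc))
    · exact hc
    · exact absurd hXlap (not_lap_pos_of_infVolume hG hXfin hXbfin hXvol hc)
  rw [hc] at hXlap hYlap'
  rw [neg_zero] at hYlap'
  intro ε hε
  obtain ⟨h₁, h₁one, h₁0, h₁1, h₁fin, h₁E⟩ :=
    exists_cutoff_energy_le hG hXfin hXbfin hXlap (by positivity : 0 < ε / 4)
  obtain ⟨h₂, h₂one, h₂0, h₂1, h₂fin, h₂E⟩ :=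
    exists_cutoff_energy_le hG hYfin hYbfin hYlap' (by positivity : 0 < ε / 4)
  have hsupp : (Function.support fun x => h₁ x + h₂ x - 1).Finite := by
    refine ((h₁fin.union h₂fin).union hKfin).subset fun x hx => ?_
    rcases huniv.symm.subset (Set.mem_univ x) with (h | h) | h
    · refine Or.inl (Or.inl ⟨h, fun h0 => hx ?_⟩)
      simp [h0, h₂one x (Set.disjoint_left.1 hXYd h)]
    · refine Or.inl (Or.inr ⟨h, fun h0 => hx ?_⟩)
      simp [h0, h₁one x (Set.disjoint_right.1 hXYd h)]
    · exact Or.inr h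
  refine ⟨fun x => h₁ x + h₂ x - 1, hsupp, fun x => ?_, ?_, ?_⟩
  · rw [abs_le]
    constructor <;> linarith [h₁0 x, h₂0 x, h₁1 x, h₂1 x]
  · obtain ⟨k⟩ := hKne
    refine ⟨k, ?_⟩
    simp [h₁one k (Set.disjoint_right.1 hXK k.2), h₂one k (Set.disjoint_right.1 hYK k.2)]
  · obtain ⟨N, hN⟩ := exists_energy_eq hG hsupp
    have hle : ∑ x ∈ N, ∑ y ∈ N, w x y *
        ((h₁ x + h₂ x - 1) - (h₁ y + h₂ y - 1)) ^ 2 ≤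
        2 * ∑ x ∈ N, ∑ y ∈ N, w x y * (h₁ x - h₁ y) ^ 2 +
          2 * ∑ x ∈ N, ∑ y ∈ N, w x y * (h₂ x - h₂ y) ^ 2 := by
      simp only [Finset.mul_sum, ← Finset.sum_add_distrib]
      refine Finset.sum_le_sum fun x _ => Finset.sum_le_sum fun y _ => ?_
      have := mul_nonneg (hG.2.2.1 x y) (sq_nonneg ((h₁ x - h₁ y) - (h₂ x - h₂ y)))
      linear_combination this
    beta_reduce
    linarith [h₁E N, h₂E N]

end SalamiPaper
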